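/- For points p_1,…,p_{24} in general position in P^3, the radical ideal I = I(1^{×24}) = ∩_{j=1}^{24} m_{p_j} satisfies γ(I) ≥ 23/9. -/

import Mathlib

open MvPolynomial Filter

/-- The homogeneous ideal of all forms vanishing at the (projective) point with
coordinate vector `p`. -/
noncomputable def pointIdeal {k : Type*} [Field k] {σ : Type*} (p : σ → k) :
    Ideal (MvPolynomial σ k) :=
  Ideal.span { f | (∃ d, f.IsHomogeneous d) ∧ eval p f = 0 }

/-- The fat points ideal `⋂ⱼ m_{pⱼ}^{mⱼ}` (natural multiplicities). -/
noncomputable def fatIdeal {k : Type*} [Field k] {N n : ℕ} (p : Fin n → (Fin (N + 1) → k))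
    (m : Fin n → ℕ) : Ideal (MvPolynomial (Fin (N + 1)) k) :=
  ⨅ j, pointIdeal (p j) ^ (m j)

/-- The fat points ideal with integer multiplicities, with the convention
`m_p^m = (1)` for `m ≤ 0`. -/
noncomputable def fatIdealZ {k : Type*} [Field k] {N n : ℕ} (p : Fin n → (Fin (N + 1) → k))
    (m : Fin n → ℤ) : Ideal (MvPolynomial (Fin (N + 1)) k) :=
  ⨅ j, pointIdeal (p j) ^ (m j).toNat

/-- The irrelevant maximal ideal `M = (x_0, …, x_N)`. -/
noncomputable def maxIdeal (k : Type*) [Field k] (N : ℕ) : Ideal (MvPolynomial (Fin (N + 1)) k) :=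
  Ideal.span (Set.range X)

/-- `α(I)`: the least `t ≥ 0` such that `I` contains a nonzero form of degree `t`. -/
noncomputable def alpha {k : Type*} [Field k] {σ : Type*}
    (I : Ideal (MvPolynomial σ k)) : ℕ :=
  sInf { t | ∃ f ∈ I, f ≠ 0 ∧ f.IsHomogeneous t }

/-- The sequence `t ↦ α(I^{(t)})/t` attached to the fat points ideal with points `p`
and multiplicities `m`; its limit as `t → ∞` is the Waldschmidt constant `γ`. -/
noncomputable def alphaSeq {k : Type*} [Field k] {N n : ℕ}
    (p : Fin n → (Fin (N + 1) → k)) (m : Fin n → ℕ) (t : ℕ) : ℝ :=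
  (alpha (fatIdeal p fun j => t * m j) : ℝ) / t

/-- `P` holds for `n`-tuples of points of `P^N` in general position: there is a
nonempty Zariski-open subset (the complement of the zero locus of a set `S` of
polynomials in the coordinates of the tuple) of tuples of nonzero coordinate
vectors on which `P` holds. -/
def Generic (k : Type*) [Field k] (N n : ℕ)
    (P : (Fin n → (Fin (N + 1) → k)) → Prop) : Prop :=
  ∃ S : Set (MvPolynomial (Fin n × Fin (N + 1)) k),
    (∃ p : Fin n → (Fin (N + 1) → k), (∀ j, p j ≠ 0) ∧
      ∃ f ∈ S, eval (fun q => p q.1 q.2) f ≠ 0) ∧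
    ∀ p : Fin n → (Fin (N + 1) → k), (∀ j, p j ≠ 0) →
      (∃ f ∈ S, eval (fun q => p q.1 q.2) f ≠ 0) → P p

/-- Translation of polynomials by the vector `p`. -/
noncomputable def trl {R σ : Type*} [CommRing R] (p : σ → R) :
    MvPolynomial σ R →ₐ[R] MvPolynomial σ R :=
  aeval (fun i => X i + C (p i))

/-- `F` vanishes to order at least `m` at the affine point `p`. -/
def Van {R σ : Type*} [CommRing R] (p : σ → R) (m : ℕ) (F : MvPolynomial σ R) : Prop :=
  ∀ b : σ →₀ ℕ, b.degree < m → coeff b (trl p F) = 0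

lemma trl_X {R σ : Type*} [CommRing R] (p : σ → R) (i : σ) :
    trl p (X i) = X i + C (p i) := by simp [trl]

lemma trl_C {R σ : Type*} [CommRing R] (p : σ → R) (c : R) :
    trl p (C c : MvPolynomial σ R) = C c := by
  simp [trl, aeval_C, MvPolynomial.algebraMap_eq]

lemma trl_neg_trl {R σ : Type*} [CommRing R] (p : σ → R) (F : MvPolynomial σ R) :
    trl (fun i => - p i) (trl p F) = F := by
  have : (trl (fun i => - p i)).comp (trl p) = AlgHom.id R (MvPolynomial σ R) := by
    ext1 i
    simp [trl_X, trl_C]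
  exact congrArg (fun h : MvPolynomial σ R →ₐ[R] MvPolynomial σ R => h F) this

lemma constantCoeff_trl {R σ : Type*} [CommRing R] (p : σ → R) (F : MvPolynomial σ R) :
    coeff 0 (trl p F) = eval p F := by
  have : (constantCoeff (σ := σ) (R := R)).comp (trl p : MvPolynomial σ R →+* MvPolynomial σ R)
      = eval p := by
    ext i
    · simp [trl_C]
    · simp [trl_X]
  exact congrArg (fun h : MvPolynomial σ R →+* R => h F) this

lemma van_iff {R σ : Type*} [CommRing R] (p : σ → R) (m : ℕ) (F : MvPolynomial σ R) :
    Van p m F ↔ F ∈ (RingHom.ker (eval p)) ^ m := by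
  unfold Van
  rw [← mem_pow_idealOfVars_iff']
  constructor
  · intro h
    have h1 := Ideal.mem_map_of_mem (trl (fun i => - p i)) h
    rw [trl_neg_trl, Ideal.map_pow] at h1
    refine Ideal.pow_right_mono ?_ m h1
    rw [Ideal.map_le_iff_le_comap, Ideal.span_le]
    rintro _ ⟨i, rfl⟩
    simp [trl_X, RingHom.mem_ker]
  · intro h
    have h1 := Ideal.mem_map_of_mem (trl p) h
    rw [Ideal.map_pow] at h1
    refine Ideal.pow_right_mono ?_ m h1
    rw [Ideal.map_le_iff_le_comap]
    intro g hg
    rw [Ideal.mem_comap, ← pow_one (idealOfVars σ R), mem_pow_idealOfVars_iff']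
    intro x hx
    have hx0 : x = 0 := by
      rw [← Finsupp.degree_eq_zero_iff]; omega
    subst hx0
    rw [constantCoeff_trl]
    exact hg

/-- Restriction to the slice `x₀ = c`. -/
noncomputable def slice {R : Type*} [CommRing R] {n : ℕ} (c : R) :
    MvPolynomial (Fin (n + 1)) R →ₐ[R] MvPolynomial (Fin n) R :=
  aeval (Fin.cons (C c) X : Fin (n + 1) → MvPolynomial (Fin n) R)

lemma eval_slice {R : Type*} [CommRing R] {n : ℕ} (c : R) (p : Fin n → R)
    (F : MvPolynomial (Fin (n + 1)) R) :
    eval p (slice c F) = eval (Fin.cons c p : Fin (n + 1) → R) F := by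
  have : (eval p).comp (slice (n := n) c : MvPolynomial (Fin (n + 1)) R →+* MvPolynomial (Fin n) R)
      = eval (Fin.cons c p : Fin (n + 1) → R) := by
    ext i
    · simp [slice, aeval_C, MvPolynomial.algebraMap_eq]
    · refine Fin.cases ?_ (fun i => ?_) i <;> simp [slice]
  exact congrArg (fun h : MvPolynomial (Fin (n + 1)) R →+* R => h F) this

lemma Van.slice {R : Type*} [CommRing R] {n : ℕ} {c : R} {p : Fin n → R} {m : ℕ}
    {F : MvPolynomial (Fin (n + 1)) R} (h : Van (Fin.cons c p : Fin (n + 1) → R) m F) :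
    Van p m (_root_.slice c F) := by
  rw [van_iff] at h ⊢
  have h1 := Ideal.mem_map_of_mem (_root_.slice c) h
  rw [Ideal.map_pow] at h1
  refine Ideal.pow_right_mono ?_ m h1
  rw [Ideal.map_le_iff_le_comap]
  intro g hg
  rw [Ideal.mem_comap, RingHom.mem_ker, eval_slice]
  exact hg

lemma dvd_of_slice_eq_zero {R : Type*} [CommRing R] {n : ℕ} {c : R}
    {F : MvPolynomial (Fin (n + 1)) R} (h : slice c F = 0) : (X 0 - C c) ∣ F := by
  rw [← Ideal.mem_span_singleton]
  set I : Ideal (MvPolynomial (Fin (n + 1)) R) := Ideal.span {X 0 - C c} with hI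
  have : ((Ideal.Quotient.mkₐ R I).comp (rename Fin.succ)).comp (slice c)
      = Ideal.Quotient.mkₐ R I := by
    ext i
    refine Fin.cases ?_ (fun i => ?_) i
    · simp only [AlgHom.comp_apply, slice, aeval_X, Fin.cons_zero, rename_C]
      refine (Ideal.Quotient.eq.2 ?_).symm
      exact Ideal.subset_span rfl
    · simp [slice]
  have h2 := congrArg (fun h : MvPolynomial (Fin (n + 1)) R →ₐ[R] _ => h F) this
  simp only [AlgHom.comp_apply, h, map_zero] at h2
  exact Ideal.Quotient.eq_zero_iff_mem.1 h2.symm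

lemma totalDegree_slice_le {R : Type*} [CommRing R] [Nontrivial R] {n : ℕ} (c : R)
    (F : MvPolynomial (Fin (n + 1)) R) : (slice c F).totalDegree ≤ F.totalDegree := by
  conv_lhs => rw [F.as_sum, map_sum]
  refine totalDegree_finsetSum_le (fun b hb => ?_)
  refine le_trans ?_ (le_totalDegree hb)
  rw [slice, aeval_monomial, Finsupp.prod_fintype _ _ (by simp), Fin.prod_univ_succ]
  simp only [Fin.cons_zero, Fin.cons_succ, MvPolynomial.algebraMap_eq, ← mul_assoc, ← C_pow,
    ← C_mul]
  rw [Finsupp.sum_fintype _ _ (by simp), Fin.sum_univ_succ]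
  refine (totalDegree_mul _ _).trans ?_
  rw [totalDegree_C, zero_add]
  refine (totalDegree_finsetProd _ _).trans ?_
  refine le_trans (Finset.sum_le_sum fun i _ => ?_) (Nat.le_add_left _ _)
  refine (totalDegree_pow _ _).trans ?_
  simp

lemma Van.mono {R σ : Type*} [CommRing R] {p : σ → R} {m m' : ℕ} {F : MvPolynomial σ R}
    (h : Van p m F) (hm : m' ≤ m) : Van p m' F := fun b hb => h b (hb.trans_le hm)

lemma Van.of_mul_eq {R : Type*} [CommRing R] {n : ℕ} {c : R} {p : Fin n → R} {m : ℕ}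
    {G : MvPolynomial (Fin (n + 1)) R}
    (h : Van (Fin.cons c p : Fin (n + 1) → R) m ((X 0 - C c) * G)) :
    Van (Fin.cons c p : Fin (n + 1) → R) (m - 1) G := by
  intro b hb
  have := h (Finsupp.single 0 1 + b) (by simp; omega)
  rwa [map_mul, map_sub, trl_X, trl_C, Fin.cons_zero, add_sub_cancel_right, coeff_X_mul] at this

lemma Van.of_mul_ne {K : Type*} [Field K] {n : ℕ} {c c' : K} (hc : c' ≠ c) {p : Fin n → K} {m : ℕ}
    {G : MvPolynomial (Fin (n + 1)) K}
    (h : Van (Fin.cons c' p : Fin (n + 1) → K) m ((X 0 - C c) * G)) :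
    Van (Fin.cons c' p : Fin (n + 1) → K) m G := by
  rw [van_iff] at h ⊢
  set I := RingHom.ker (eval (Fin.cons c' p : Fin (n + 1) → K))
  set u : K := c' - c with hu
  have hu0 : u ≠ 0 := sub_ne_zero.2 hc
  have h1 : (C u - (X 0 - C c) : MvPolynomial (Fin (n + 1)) K) ∈ I := by
    simp [I, RingHom.mem_ker, hu]
  have h2 := Ideal.pow_mem_pow h1 m
  obtain ⟨w, hw⟩ := sub_dvd_pow_sub_pow (C u : MvPolynomial (Fin (n + 1)) K)
    (C u - (X 0 - C c)) m
  rw [sub_sub_cancel] at hw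
  have h3 : C (u ^ m) * G ∈ I ^ m := by
    have : C (u ^ m) * G = (C u - (X 0 - C c)) ^ m * G + w * ((X 0 - C c) * G) := by
      rw [C_pow]
      linear_combination G * hw
    rw [this]
    exact Ideal.add_mem _ (Ideal.mul_mem_right _ _ h2) (Ideal.mul_mem_left _ _ h)
  have h4 := Ideal.mul_mem_left _ (C ((u ^ m)⁻¹)) h3
  rwa [← mul_assoc, ← C_mul, inv_mul_cancel₀ (pow_ne_zero _ hu0), C_1, one_mul] at h4

/-- The point set `T` has Waldschmidt-type bound `s`. -/
def ZBound {K : Type*} [Field K] {n : ℕ} (T : Set (Fin n → K)) (s : ℕ) : Prop :=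
  ∀ (d a : ℕ) (F : MvPolynomial (Fin n) K), F.totalDegree ≤ d → (∀ p ∈ T, Van p a F) →
    d < s * a → F = 0

lemma peel {K : Type*} [Field K] {n : ℕ} {T : Set (Fin n → K)} {s : ℕ} (hT : ZBound T s)
    {d a : ℕ} {c : K} {F : MvPolynomial (Fin (n + 1)) K} (hF : F ≠ 0) (hd : F.totalDegree ≤ d)
    (hv : ∀ p ∈ T, Van (Fin.cons c p : Fin (n + 1) → K) a F) (hlt : d < s * a) :
    ∃ G : MvPolynomial (Fin (n + 1)) K, G ≠ 0 ∧ G.totalDegree + 1 ≤ d ∧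
      (∀ p m, Van (Fin.cons c p : Fin (n + 1) → K) m F →
        Van (Fin.cons c p : Fin (n + 1) → K) (m - 1) G) ∧
      (∀ c' p m, c' ≠ c → Van (Fin.cons c' p : Fin (n + 1) → K) m F →
        Van (Fin.cons c' p : Fin (n + 1) → K) m G) := by
  have h0 : slice c F = 0 :=
    hT d a _ ((totalDegree_slice_le c F).trans hd) (fun p hp => (hv p hp).slice) hlt
  obtain ⟨G, rfl⟩ := dvd_of_slice_eq_zero h0
  have hG : G ≠ 0 := right_ne_zero_of_mul hF
  have hX : (X 0 - C c : MvPolynomial (Fin (n + 1)) K) ≠ 0 := left_ne_zero_of_mul hF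
  refine ⟨G, hG, ?_, fun p m h => h.of_mul_eq, fun c' p m hc h => h.of_mul_ne hc⟩
  rw [totalDegree_mul_of_isDomain hX hG] at hd
  have h1 : (X 0 - C c : MvPolynomial (Fin (n + 1)) K).totalDegree ≠ 0 := by
    intro h
    rw [totalDegree_eq_zero_iff_eq_C] at h
    have h2 := congrArg (coeff (Finsupp.single 0 1)) h
    simp [coeff_C, coeff_X', Finsupp.single_eq_zero, eq_comm] at h2
  omega

lemma zbound_zero {K : Type*} [Field K] (s : ℕ) (T : Set (Fin 0 → K)) (hT : T.Nonempty) :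
    ZBound T s := by
  intro d a F _ hv hlt
  obtain ⟨p, hp⟩ := hT
  have ha : 0 < a := Nat.pos_of_ne_zero (by rintro rfl; simp at hlt)
  have := hv p hp 0 (by simpa using ha)
  rw [constantCoeff_trl] at this
  rw [eq_C_of_isEmpty F] at this ⊢
  simp only [eval_C] at this
  rw [this, C_0]

lemma zbound_succ {K : Type*} [Field K] [CharZero K] {n s : ℕ} {T : Set (Fin n → K)}
    (hT : ZBound T s) :
    ZBound {q : Fin (n + 1) → K | ∃ i < s, ∃ p ∈ T, q = Fin.cons (i : K) p} s := by
  have key : ∀ (d : ℕ) (a : Fin s → ℕ) (F : MvPolynomial (Fin (n + 1)) K), F.totalDegree ≤ d →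
      (∀ i : Fin s, ∀ p ∈ T, Van (Fin.cons ((i : ℕ) : K) p : Fin (n + 1) → K) (a i) F) →
      d < ∑ i, a i → F = 0 := by
    intro d
    induction d with
    | zero =>
      intro a F hd hv hlt
      by_contra hF
      have : ∃ i, 0 < s * a i := by
        by_contra! hcon
        have : ∑ i, a i = 0 := Finset.sum_eq_zero fun i _ => by
          have := hcon i
          have hs : 0 < s := i.pos
          simpa [hs.ne'] using this
        omega
      obtain ⟨i, hi⟩ := this
      obtain ⟨G, -, h, -⟩ := peel hT hF hd (hv i) hi
      omega
    | succ d ih =>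
      intro a F hd hv hlt
      by_contra hF
      have : ∃ i, d + 1 < s * a i := by
        by_contra! hcon
        have h1 : ∑ i : Fin s, s * a i ≤ ∑ i : Fin s, (d + 1) :=
          Finset.sum_le_sum fun i _ => hcon i
        rw [← Finset.mul_sum] at h1
        simp only [Finset.sum_const, Finset.card_univ, Fintype.card_fin, smul_eq_mul] at h1
        have hs : 0 < s := by
          rcases Nat.eq_zero_or_pos s with rfl | h
          · simp at hlt
          · exact h
        have := Nat.le_of_mul_le_mul_left h1 hs
        omega
      obtain ⟨i, hi⟩ := this
      obtain ⟨G, hG, h, h1, h2⟩ := peel hT hF hd (hv i) hi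
      refine hG (ih (Function.update a i (a i - 1)) G (by omega) ?_ ?_)
      · intro j p hp
        by_cases hj : j = i
        · subst hj
          simpa using h1 p _ (hv j p hp)
        · rw [Function.update_of_ne hj]
          refine h2 _ p _ ?_ (hv j p hp)
          intro hh
          exact hj (Fin.ext (Nat.cast_injective hh))
      · have hpos : 0 < a i := Nat.pos_of_ne_zero (by intro h0; simp [h0] at hi)
        have e1 := Finset.sum_update_of_mem (Finset.mem_univ i) a (a i - 1)
        have e2 := Finset.add_sum_erase Finset.univ a (Finset.mem_univ i)
        rw [← Finset.erase_eq] at e1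
        omega
  intro d a F hd hv hlt
  refine key d (fun _ => a) F hd (fun i p hp => hv _ ⟨i, i.2, p, hp, rfl⟩) ?_
  simpa using hlt

/-- The `s × s` grid. -/
def grid (K : Type*) [Field K] (s : ℕ) : Set (Fin 2 → K) :=
  {q | ∃ i < s, ∃ j < s, q = ![(i : K), (j : K)]}

lemma zbound_grid (K : Type*) [Field K] [CharZero K] (s : ℕ) : ZBound (grid K s) s := by
  have h := zbound_succ (zbound_succ (zbound_zero s (Set.univ : Set (Fin 0 → K)) ⟨0, trivial⟩))
  intro d a F hd hv hlt
  refine h d a F hd ?_ hlt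
  rintro q ⟨i, hi, _, ⟨j, hj, p, -, rfl⟩, rfl⟩
  refine hv _ ⟨i, hi, j, hj, ?_⟩
  ext t
  fin_cases t <;> rfl

lemma special3 {K : Type*} [Field K] [CharZero K] : ∀ (d a b c : ℕ)
    (F : MvPolynomial (Fin 3) K), F.totalDegree ≤ d →
    (∀ p ∈ grid K 3, Van (Fin.cons (0 : K) p : Fin 3 → K) a F) →
    (∀ p ∈ grid K 3, Van (Fin.cons (1 : K) p : Fin 3 → K) b F) →
    (∀ p ∈ grid K 2, Van (Fin.cons (2 : K) p : Fin 3 → K) c F) →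
    d + 24 = a + b + c → (d < 138 ∨ c = 69) → F = 0 := by
  intro d
  induction d with
  | zero =>
    intro a b c F hd ha hb hc h1 h2
    by_contra hF
    have : 0 < 3 * a ∨ 0 < 3 * b ∨ 0 < 2 * c := by omega
    rcases this with h | h | h
    · obtain ⟨G, -, h, -⟩ := peel (zbound_grid K 3) hF hd ha h
      omega
    · obtain ⟨G, -, h, -⟩ := peel (zbound_grid K 3) hF hd hb h
      omega
    · obtain ⟨G, -, h, -⟩ := peel (zbound_grid K 2) hF hd hc h
      omega
  | succ d ih =>
    intro a b c F hd ha hb hc h1 h2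
    by_contra hF
    have : d + 1 < 3 * a ∨ d + 1 < 3 * b ∨ (d + 1 < 138 ∧ d + 1 < 2 * c) := by omega
    have h20 : (2 : K) ≠ 0 := two_ne_zero
    have h21 : (2 : K) ≠ 1 := by norm_num
    rcases this with h | h | h
    · obtain ⟨G, hG, h3, h4, h5⟩ := peel (zbound_grid K 3) hF hd ha h
      exact hG (ih (a - 1) b c G (by omega) (fun p hp => h4 p _ (ha p hp))
        (fun p hp => h5 _ p _ one_ne_zero (hb p hp)) (fun p hp => h5 _ p _ h20 (hc p hp))
        (by omega) (by omega))
    · obtain ⟨G, hG, h3, h4, h5⟩ := peel (zbound_grid K 3) hF hd hb h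
      exact hG (ih a (b - 1) c G (by omega) (fun p hp => h5 _ p _ zero_ne_one (ha p hp))
        (fun p hp => h4 p _ (hb p hp)) (fun p hp => h5 _ p _ h21 (hc p hp))
        (by omega) (by omega))
    · obtain ⟨G, hG, h3, h4, h5⟩ := peel (zbound_grid K 2) hF hd hc h.2
      exact hG (ih a b (c - 1) G (by omega) (fun p hp => h5 _ p _ h20.symm (ha p hp))
        (fun p hp => h5 _ p _ h21.symm (hb p hp)) (fun p hp => h4 p _ (hc p hp))
        (by omega) (by omega))

/-- The special configuration of `24` points. -/
def specialPt (K : Type*) [Field K] (j : Fin 24) : Fin 4 → K :=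
  ![1, ((j.1 / 9 : ℕ) : K), ((j.1 % 9 / 3 : ℕ) : K), ((j.1 % 3 : ℕ) : K)]

lemma homog_eval_smul {K σ : Type*} [Field K] [Fintype σ] {d : ℕ} {f : MvPolynomial σ K}
    (hf : f.IsHomogeneous d) (u : K) (x : σ → K) : eval (u • x) f = u ^ d * eval x f := by
  rw [eval_eq', eval_eq', Finset.mul_sum]
  refine Finset.sum_congr rfl fun b hb => ?_
  have h : b.degree = d := by
    have := hf (mem_support_iff.1 hb)
    rwa [Finsupp.degree_eq_weight_one]
  simp only [Pi.smul_apply, smul_eq_mul, mul_pow, Finset.prod_mul_distrib]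
  rw [Finset.prod_pow_eq_pow_sum, ← Finsupp.degree_eq_sum, h]
  ring

lemma homog_slice_one_ne {K : Type*} [Field K] [CharZero K] {n d : ℕ}
    {f : MvPolynomial (Fin (n + 1)) K} (hf : f.IsHomogeneous d) (h : slice 1 f = 0) : f = 0 := by
  have h1 : ∀ v : Fin n → K, eval (Fin.cons 1 v : Fin (n + 1) → K) f = 0 := by
    intro v
    rw [← eval_slice, h, map_zero]
  have h2 : X 0 * f = 0 := by
    apply MvPolynomial.funext
    intro x
    rw [map_mul, eval_X, map_zero]
    by_cases hx : x 0 = 0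
    · rw [hx, zero_mul]
    · have h3 : x = x 0 • (Fin.cons 1 (fun i => x i.succ / x 0) : Fin (n + 1) → K) := by
        ext i
        refine Fin.cases ?_ (fun i => ?_) i
        · simp
        · simp; field_simp
      have h4 := h1 (fun i => x i.succ / x 0)
      rw [h3, homog_eval_smul hf, h4]
      simp
  exact (mul_eq_zero.1 h2).resolve_left (X_ne_zero 0)

lemma special_main {K : Type*} [Field K] [CharZero K] {f : MvPolynomial (Fin 4) K}
    (hf : f.IsHomogeneous 183) (hv : ∀ j, Van (specialPt K j) 69 f) : f = 0 := by
  apply homog_slice_one_ne hf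
  have hpt : ∀ z i j : ℕ, z * 9 + i * 3 + j < 24 → i < 3 → j < 3 →
      Van (Fin.cons (z : K) ![(i : K), (j : K)] : Fin 3 → K) 69 (slice 1 f) := by
    intro z i j h hi hj
    apply Van.slice
    have := hv ⟨z * 9 + i * 3 + j, h⟩
    have e1 : (z * 9 + i * 3 + j) / 9 = z := by omega
    have e2 : (z * 9 + i * 3 + j) % 9 / 3 = i := by omega
    have e3 : (z * 9 + i * 3 + j) % 3 = j := by omega
    have e : specialPt K ⟨z * 9 + i * 3 + j, h⟩ =
        (Fin.cons 1 (Fin.cons (z : K) ![(i : K), (j : K)] : Fin 3 → K) : Fin 4 → K) := by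
      simp only [specialPt, e1, e2, e3]
      rfl
    rwa [e] at this
  refine special3 183 69 69 69 _ ((totalDegree_slice_le _ _).trans hf.totalDegree_le) ?_ ?_ ?_
    (by norm_num) (by norm_num)
  · rintro _ ⟨i, hi, j, hj, rfl⟩
    simpa using hpt 0 i j (by omega) hi hj
  · rintro _ ⟨i, hi, j, hj, rfl⟩
    simpa using hpt 1 i j (by omega) hi hj
  · rintro _ ⟨i, hi, j, hj, rfl⟩
    simpa using hpt 2 i j (by omega) (by omega) (by omega)

open Classical in
/-- The Cartier-type operator extracting the coefficients of exponents `a + q b`. -/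
noncomputable def cart {R σ : Type*} [CommRing R] (q : ℕ) (a : σ →₀ ℕ)
    (f : MvPolynomial σ R) : MvPolynomial σ R :=
  ∑ c ∈ f.support, if h : ∃ b, c = a + q • b then monomial h.choose (coeff c f) else 0

lemma coeff_cart {R σ : Type*} [CommRing R] {q : ℕ} (hq : q ≠ 0) (a : σ →₀ ℕ)
    (f : MvPolynomial σ R) (b : σ →₀ ℕ) : coeff b (cart q a f) = coeff (a + q • b) f := by
  classical
  have hinj : ∀ b b' : σ →₀ ℕ, a + q • b = a + q • b' → b = b' := by
    intro b b' h
    ext i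
    have := DFunLike.congr_fun h i
    simp only [Finsupp.add_apply, Finsupp.smul_apply, smul_eq_mul] at this
    exact Nat.eq_of_mul_eq_mul_left (Nat.pos_of_ne_zero hq) (by omega)
  rw [cart, coeff_sum, Finset.sum_eq_single (a + q • b)]
  · have h : ∃ b', a + q • b = a + q • b' := ⟨b, rfl⟩
    rw [dif_pos h, ← hinj _ _ h.choose_spec, coeff_monomial, if_pos rfl]
  · intro c _ hc
    split_ifs with h
    · rw [coeff_monomial, if_neg]
      intro h'
      exact hc (h' ▸ h.choose_spec)
    · simp
  · intro h
    rw [notMem_support_iff] at h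
    split_ifs <;> simp [h]

lemma cart_add {R σ : Type*} [CommRing R] {q : ℕ} (hq : q ≠ 0) (a : σ →₀ ℕ)
    (f g : MvPolynomial σ R) : cart q a (f + g) = cart q a f + cart q a g := by
  ext b
  simp [coeff_cart hq]

lemma cart_sum {R σ ι : Type*} [CommRing R] {q : ℕ} (hq : q ≠ 0) (a : σ →₀ ℕ)
    (s : Finset ι) (f : ι → MvPolynomial σ R) :
    cart q a (∑ i ∈ s, f i) = ∑ i ∈ s, cart q a (f i) := by
  ext b
  simp [coeff_cart hq, coeff_sum]

lemma cart_expand_mul {R σ : Type*} [CommRing R] {q : ℕ} (hq : q ≠ 0) {a : σ →₀ ℕ}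
    (ha : ∀ i, a i < q) (h f : MvPolynomial σ R) :
    cart q a (expand q h * f) = h * cart q a f := by
  classical
  induction h using MvPolynomial.induction_on' with
  | add p r hp hr => rw [map_add, add_mul, add_mul, cart_add hq, hp, hr]
  | monomial c r =>
    ext b
    rw [coeff_cart hq, expand_monomial, coeff_monomial_mul', coeff_monomial_mul']
    have hiff : q • c ≤ a + q • b ↔ c ≤ b := by
      constructor
      · intro h i
        have h1 := h i
        have h2 := ha i
        simp only [Finsupp.add_apply, Finsupp.smul_apply, smul_eq_mul] at h1
        by_contra hcon
        have : b i + 1 ≤ c i := by omega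
        have := Nat.mul_le_mul_left q this
        rw [Nat.mul_add] at this
        omega
      · intro h i
        have := Nat.mul_le_mul_left q (h i)
        simp only [Finsupp.add_apply, Finsupp.smul_apply, smul_eq_mul]
        omega
    by_cases hc : c ≤ b
    · rw [if_pos (hiff.2 hc), if_pos hc, coeff_cart hq]
      congr 2
      obtain ⟨e, rfl⟩ := exists_add_of_le hc
      ext i
      simp only [Finsupp.tsub_apply, Finsupp.add_apply, Finsupp.smul_apply, smul_eq_mul,
        Nat.mul_add, Nat.add_sub_cancel_left]
      omega
    · rw [if_neg (fun h => hc (hiff.1 h)), if_neg hc]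

lemma frob_expand {K σ : Type*} [Field K] [Fintype K] (e : ℕ) (i : σ) (c : K) :
    (X i - C c : MvPolynomial σ K) ^ (Fintype.card K ^ e)
      = expand (Fintype.card K ^ e) (X i - C c) := by
  obtain ⟨p, hp⟩ := CharP.exists K
  obtain ⟨n, hpr, hn⟩ := FiniteField.card K p
  have := Fact.mk hpr
  have h1 := FiniteField.pow_card_pow e c
  rw [map_sub, expand_X, expand_C]
  conv_rhs => rw [← h1]
  rw [hn, ← pow_mul, sub_pow_char_pow, C_pow]

lemma cart_van {K : Type*} [Field K] [Fintype K] (e : ℕ) (p : Fin 4 → K) (m : ℕ)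
    {a : Fin 4 →₀ ℕ} (ha : ∀ i, a i < Fintype.card K ^ e) {f : MvPolynomial (Fin 4) K}
    (hf : Van p ((m + 3) * Fintype.card K ^ e) f) :
    Van p m (cart (Fintype.card K ^ e) a f) := by
  have hfr := frob_expand (K := K) (σ := Fin 4) e
  have hq : Fintype.card K ^ e ≠ 0 := pow_ne_zero _ Fintype.card_ne_zero
  generalize Fintype.card K ^ e = q at *
  rw [van_iff]
  conv_rhs => rw [← trl_neg_trl p f, (trl p f).as_sum, map_sum, cart_sum hq]
  refine Ideal.sum_mem _ fun b hb => ?_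
  have hdeg : (m + 3) * q ≤ b.degree := by
    by_contra hcon
    exact (mem_support_iff.1 hb) (hf b (not_le.1 hcon))
  have hsplit : trl (fun i => - p i) (monomial b (coeff b (trl p f))) =
      expand q (∏ i, (X i - C (p i)) ^ (b i / q)) *
        (C (coeff b (trl p f)) * ∏ i, (X i - C (p i)) ^ (b i % q)) := by
    have e1 : trl (fun i => - p i) (monomial b (coeff b (trl p f))) =
        C (coeff b (trl p f)) * ∏ i, (X i - C (p i)) ^ (b i) := by
      generalize coeff b (trl p f) = r
      unfold trl
      rw [aeval_monomial, Finsupp.prod_fintype _ _ (fun i => pow_zero _),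
        MvPolynomial.algebraMap_eq]
      simp only [C_neg, sub_eq_add_neg]
    have e2 : expand q (∏ i, (X i - C (p i)) ^ (b i / q)) =
        ∏ i, (X i - C (p i)) ^ (q * (b i / q)) := by
      rw [map_prod]
      refine Finset.prod_congr rfl fun i _ => ?_
      rw [map_pow, ← hfr, ← pow_mul]
    rw [e1, e2, mul_left_comm, ← Finset.prod_mul_distrib]
    refine congrArg _ (Finset.prod_congr rfl fun i _ => ?_)
    rw [← pow_add, Nat.div_add_mod]
  rw [hsplit, cart_expand_mul hq ha]
  refine Ideal.mul_mem_right _ _ ?_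
  have hle : m ≤ ∑ i, b i / q := by
    rw [Finsupp.degree_eq_sum] at hdeg
    have h1 : ∀ i, b i + 1 ≤ q * (b i / q) + q := fun i => by
      have := Nat.div_add_mod (b i) q
      have := Nat.mod_lt (b i) (Nat.pos_of_ne_zero hq)
      omega
    have h2 := Finset.sum_le_sum (fun i (_ : i ∈ Finset.univ) => h1 i)
    rw [Finset.sum_add_distrib, Finset.sum_add_distrib, ← Finset.mul_sum] at h2
    simp only [Finset.sum_const, Finset.card_univ, Fintype.card_fin, smul_eq_mul] at h2
    by_contra hcon
    have h3 : ∑ i, b i / q + 1 ≤ m := by omega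
    have h4 := Nat.mul_le_mul_left q h3
    have h5 : (m + 3) * q = q * m + 3 * q := by ring
    rw [Nat.mul_add] at h4
    omega
  refine Ideal.pow_le_pow_right hle ?_
  rw [← Finset.prod_pow_eq_pow_sum]
  refine Ideal.prod_mem_prod fun i _ => Ideal.pow_mem_pow ?_ _
  simp [RingHom.mem_ker]

lemma Van.mul_left {R σ : Type*} [CommRing R] {p : σ → R} {m : ℕ} {F : MvPolynomial σ R}
    (h : Van p m F) (G : MvPolynomial σ R) : Van p m (G * F) := by
  rw [van_iff] at *
  exact Ideal.mul_mem_left _ _ h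

lemma homog_degree {R σ : Type*} [CommRing R] {d : ℕ} {f : MvPolynomial σ R}
    (hf : f.IsHomogeneous d) {b : σ →₀ ℕ} (hb : coeff b f ≠ 0) : b.degree = d := by
  have := hf hb
  rwa [Finsupp.degree_eq_weight_one]

lemma homog_of_degree {R σ : Type*} [CommRing R] {d : ℕ} {f : MvPolynomial σ R}
    (h : ∀ b, coeff b f ≠ 0 → b.degree = d) : f.IsHomogeneous d := by
  intro b hb
  have := h b hb
  rwa [Finsupp.degree_eq_weight_one] at this

lemma fin_main {K : Type*} [Field K] [Fintype K] {ι : Type*} (p : ι → Fin 4 → K)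
    (H : ∀ g : MvPolynomial (Fin 4) K, g.IsHomogeneous 183 → (∀ j, Van (p j) 69 g) → g = 0)
    {d t : ℕ} (ht : 0 < t) {f : MvPolynomial (Fin 4) K} (hf0 : f ≠ 0) (hf : f.IsHomogeneous d)
    (hv : ∀ j, Van (p j) t f) : 184 * t ≤ 72 * d := by
  by_contra! hcon
  set e := t * d + 1 with he
  have hbig : t * d < Fintype.card K ^ e :=
    lt_trans (Nat.lt_succ_self _) (Nat.lt_pow_self Fintype.one_lt_card)
  have hcart := fun (p : Fin 4 → K) (a : Fin 4 →₀ ℕ) => cart_van e p 69 (a := a) (f := f ^ (72 * (Fintype.card K ^ e) / t + 1))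
  have hq : Fintype.card K ^ e ≠ 0 := pow_ne_zero _ Fintype.card_ne_zero
  generalize Fintype.card K ^ e = q at *
  set s := 72 * q / t + 1 with hs
  have hs1 : 72 * q ≤ t * s := by
    have := Nat.div_add_mod (72 * q) t
    have := Nat.mod_lt (72 * q) ht
    rw [hs, Nat.mul_add]
    omega
  have hs2 : t * s ≤ 72 * q + t := by
    have := Nat.div_add_mod (72 * q) t
    rw [hs, Nat.mul_add]
    omega
  have hfs0 : f ^ s ≠ 0 := pow_ne_zero _ hf0
  have hfs : (f ^ s).IsHomogeneous (d * s) := hf.pow s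
  have hvs : ∀ j, Van (p j) (72 * q) (f ^ s) := by
    intro j
    have := hv j
    rw [van_iff] at this ⊢
    have h2 := Ideal.pow_mem_pow this s
    rw [← pow_mul] at h2
    exact Ideal.pow_le_pow_right hs1 h2
  obtain ⟨c, hc⟩ := (support_nonempty (p := f ^ s)).2 hfs0
  set a : Fin 4 →₀ ℕ := Finsupp.equivFunOnFinite.symm (fun i => c i % q) with ha
  set b : Fin 4 →₀ ℕ := Finsupp.equivFunOnFinite.symm (fun i => c i / q) with hb
  have hab : a + q • b = c := by
    ext i
    simp [ha, hb, Nat.mod_add_div]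
  have haq : ∀ i, a i < q := fun i => Nat.mod_lt _ (Nat.pos_of_ne_zero hq)
  set g := cart q a (f ^ s) with hg
  have hgb : coeff b g ≠ 0 := by
    rw [hg, coeff_cart hq, hab]
    exact mem_support_iff.1 hc
  have hdegs : ∀ b', coeff b' g ≠ 0 → a.degree + q * b'.degree = d * s := by
    intro b' hb'
    rw [hg, coeff_cart hq] at hb'
    have := homog_degree hfs hb'
    simpa using this
  have hghom : g.IsHomogeneous b.degree := by
    refine homog_of_degree fun b' hb' => ?_
    have h1 := hdegs b' hb'
    have h2 := hdegs b hgb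
    exact Nat.eq_of_mul_eq_mul_left (Nat.pos_of_ne_zero hq) (by omega)
  have hgv : ∀ j, Van (p j) 69 g := fun j => hcart (p j) a haq (hvs j)
  have h184 : 184 ≤ b.degree := by
    by_contra! hlt
    have h1 : (X 0 ^ (183 - b.degree) * g : MvPolynomial (Fin 4) K).IsHomogeneous 183 := by
      have := (isHomogeneous_X_pow (R := K) (0 : Fin 4) (183 - b.degree)).mul hghom
      rwa [Nat.sub_add_cancel (by omega)] at this
    have h2 := H _ h1 (fun j => (hgv j).mul_left _)
    have h3 := (mul_eq_zero.1 h2).resolve_left (pow_ne_zero _ (X_ne_zero 0))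
    exact hgb (by rw [h3, coeff_zero])
  have h1 : q * 184 ≤ d * s := by
    have h2 := hdegs b hgb
    have := Nat.mul_le_mul_left q h184
    omega
  have h2 : 184 * t * q ≤ 72 * d * q + t * d := by
    calc 184 * t * q = t * (q * 184) := by ring
      _ ≤ t * (d * s) := Nat.mul_le_mul_left _ h1
      _ = d * (t * s) := by ring
      _ ≤ d * (72 * q + t) := Nat.mul_le_mul_left _ hs2
      _ = 72 * d * q + t * d := by ring
  have h3 : (72 * d + 1) * q ≤ 184 * t * q := Nat.mul_le_mul_right _ hcon
  rw [Nat.add_mul, one_mul] at h3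
  omega

universe u

/-- Exponents of degree `183`. -/
abbrev ColIdx : Type := {a : Fin 4 →₀ ℕ // a.degree = 183}

/-- Conditions imposed by `24` points of multiplicity `69`. -/
abbrev RowIdx : Type := Fin 24 × {b : Fin 4 →₀ ℕ // b.degree < 69}

noncomputable instance colFintype : Fintype ColIdx :=
  have : Finite ColIdx := (Finsupp.finite_of_degree_eq 183).to_subtype
  Fintype.ofFinite _

noncomputable instance rowFintype : Fintype {b : Fin 4 →₀ ℕ // b.degree < 69} :=
  have : Finite {b : Fin 4 →₀ ℕ // b.degree < 69} := (Finsupp.finite_of_degree_lt 69).to_subtype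
  Fintype.ofFinite _

/-- The interpolation matrix. -/
noncomputable def interp {R : Type*} [CommRing R] (p : Fin 24 → Fin 4 → R) :
    Matrix RowIdx ColIdx R :=
  fun r c => coeff r.2.1 (trl (p r.1) (monomial c.1 1))

lemma map_trl {R S σ : Type*} [CommRing R] [CommRing S] (φ : R →+* S) (p : σ → R)
    (F : MvPolynomial σ R) : MvPolynomial.map φ (trl p F) = trl (fun i => φ (p i)) (MvPolynomial.map φ F) := by
  have : (MvPolynomial.map φ).comp (trl p : MvPolynomial σ R →+* MvPolynomial σ R) =
      (trl (fun i => φ (p i)) : MvPolynomial σ S →+* MvPolynomial σ S).comp (MvPolynomial.map φ) := by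
    refine MvPolynomial.ringHom_ext (fun c => ?_) (fun i => ?_)
    · simp [trl_C]
    · simp [trl_X]
  exact congrArg (fun h : MvPolynomial σ R →+* MvPolynomial σ S => h F) this

lemma interp_map {R S : Type*} [CommRing R] [CommRing S] (φ : R →+* S)
    (p : Fin 24 → Fin 4 → R) : (interp p).map φ = interp (fun j i => φ (p j i)) := by
  ext r c
  simp only [interp, Matrix.map_apply]
  rw [← coeff_map, map_trl, map_monomial, map_one]

lemma homog_eq_sum {R : Type*} [CommRing R] {g : MvPolynomial (Fin 4) R}
    (hg : g.IsHomogeneous 183) : g = ∑ c : ColIdx, C (coeff c.1 g) * monomial c.1 1 := by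
  classical
  ext b
  rw [coeff_sum]
  simp only [coeff_C_mul, coeff_monomial, mul_ite, mul_one, mul_zero]
  by_cases hb : b.degree = 183
  · rw [Finset.sum_eq_single (⟨b, hb⟩ : ColIdx)]
    · simp
    · intro c _ hc
      rw [if_neg]
      intro h
      exact hc (Subtype.ext h)
    · simp
  · rw [Finset.sum_eq_zero]
    · by_contra h
      exact hb (homog_degree hg h)
    · intro c _
      rw [if_neg]
      intro h
      exact hb (h ▸ c.2)

lemma interp_mulVec {R : Type*} [CommRing R] (p : Fin 24 → Fin 4 → R) (v : ColIdx → R)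
    (r : RowIdx) : (interp p).mulVec v r =
      coeff r.2.1 (trl (p r.1) (∑ c : ColIdx, C (v c) * monomial c.1 1)) := by
  rw [map_sum, coeff_sum]
  simp only [Matrix.mulVec, dotProduct, interp]
  refine Finset.sum_congr rfl fun c _ => ?_
  rw [map_mul, trl_C, coeff_C_mul, mul_comm]

open Classical in
lemma no_form_of_det {K : Type*} [Field K] (p : Fin 24 → Fin 4 → K) (L : Matrix ColIdx RowIdx K)
    (hL : (L * interp p).det ≠ 0) (g : MvPolynomial (Fin 4) K) (hg : g.IsHomogeneous 183)
    (hv : ∀ j, Van (p j) 69 g) : g = 0 := by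
  have h1 : (interp p).mulVec (fun c : ColIdx => coeff c.1 g) = 0 := by
    ext r
    rw [interp_mulVec, ← homog_eq_sum hg]
    exact hv r.1 r.2.1 r.2.2
  have h2 : (L * interp p).mulVec (fun c : ColIdx => coeff c.1 g) = 0 := by
    rw [← Matrix.mulVec_mulVec, h1, Matrix.mulVec_zero]
  have h3 := Matrix.eq_zero_of_mulVec_eq_zero hL h2
  rw [homog_eq_sum hg]
  refine Finset.sum_eq_zero fun c _ => ?_
  rw [show coeff c.1 g = 0 from congrFun h3 c, C_0, zero_mul]

open Classical in
lemma exists_left_inv (K : Type*) [Field K] [CharZero K] :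
    ∃ L : Matrix ColIdx RowIdx K, L * interp (specialPt K) = 1 := by
  suffices hker : LinearMap.ker (Matrix.toLin' (interp (specialPt K))) = ⊥ by
    obtain ⟨g, hg⟩ := LinearMap.exists_leftInverse_of_injective _ hker
    refine ⟨LinearMap.toMatrix' g, ?_⟩
    have := congrArg LinearMap.toMatrix' hg
    rwa [LinearMap.toMatrix'_comp, LinearMap.toMatrix'_toLin', LinearMap.toMatrix'_id] at this
  rw [LinearMap.ker_eq_bot']
  intro v hv
  set g : MvPolynomial (Fin 4) K := ∑ c : ColIdx, C (v c) * monomial c.1 1 with hg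
  have hco : ∀ c : ColIdx, coeff c.1 g = v c := by
    intro c
    rw [hg, coeff_sum, Finset.sum_eq_single c]
    · simp
    · intro c' _ hc'
      rw [coeff_C_mul, coeff_monomial, if_neg (fun h => hc' (Subtype.ext h)), mul_zero]
    · simp
  have hhom : g.IsHomogeneous 183 := by
    refine IsHomogeneous.sum _ _ _ fun c _ => ?_
    rw [C_mul_monomial]
    refine isHomogeneous_monomial _ c.2
  have h0 : g = 0 := by
    refine special_main hhom fun j b hb => ?_
    have := congrFun hv (j, ⟨b, hb⟩)
    rwa [Matrix.toLin'_apply, interp_mulVec] at this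
  ext c
  rw [← hco, h0]
  simp

lemma int_jacobson : IsJacobsonRing ℤ := by
  rw [isJacobsonRing_iff_prime_eq]
  intro P hP
  by_cases h : P = ⊥
  · subst h
    rw [eq_bot_iff]
    intro x hx
    rw [Ideal.mem_jacobson_bot] at hx
    have h1 := Int.isUnit_iff.1 (hx x)
    rw [Ideal.mem_bot]
    have h2 : 0 ≤ x * x := mul_self_nonneg x
    exact mul_self_eq_zero.1 (by omega)
  · have : P.IsMaximal := hP.isMaximal h
    exact Ideal.jacobson_eq_self_of_isMaximal

lemma exists_finite_field (A : Type u) [CommRing A] [Nontrivial A] [Algebra.FiniteType ℤ A] :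
    ∃ (F : Type u) (_ : Field F) (_ : Finite F), Nonempty (A →+* F) := by
  obtain ⟨M, hM⟩ := Ideal.exists_maximal A
  let _ : Field (A ⧸ M) := Ideal.Quotient.field M
  refine ⟨A ⧸ M, inferInstance, ?_, ⟨Ideal.Quotient.mk M⟩⟩
  have hft : Algebra.FiniteType ℤ (A ⧸ M) :=
    Algebra.FiniteType.of_surjective (Ideal.Quotient.mkₐ ℤ M) (Ideal.Quotient.mkₐ_surjective ℤ M)
  have := int_jacobson
  have hfin : Module.Finite ℤ (A ⧸ M) := finite_of_finite_type_of_isJacobsonRing ℤ (A ⧸ M)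
  obtain ⟨p, hp⟩ := CharP.exists (A ⧸ M)
  have hp0 : p ≠ 0 := by
    rintro rfl
    have : CharZero (A ⧸ M) := CharP.charP_to_charZero _
    have hinj : Function.Injective (algebraMap ℤ (A ⧸ M)) := by
      intro a b hab
      simpa using hab
    exact Int.not_isField (isField_of_isIntegral_of_isField hinj (Field.toIsField (A ⧸ M)))
  refine Module.finite_of_fg_torsion (A ⧸ M) ?_
  intro x
  refine ⟨⟨(p : ℤ), mem_nonZeroDivisors_of_ne_zero (by exact_mod_cast hp0)⟩, ?_⟩
  change (p : ℤ) • x = 0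
  rw [zsmul_eq_mul]
  simp [CharP.cast_eq_zero]

lemma Van.map {R S σ : Type*} [CommRing R] [CommRing S] (φ : R →+* S) {p : σ → R} {m : ℕ}
    {F : MvPolynomial σ R} (h : Van p m F) :
    Van (fun i => φ (p i)) m (MvPolynomial.map φ F) := by
  intro b hb
  rw [← map_trl, coeff_map, h b hb, map_zero]

lemma Van.of_map {R S σ : Type*} [CommRing R] [CommRing S] (φ : R →+* S)
    (hφ : Function.Injective φ) {p : σ → R} {m : ℕ}
    {F : MvPolynomial σ R} (h : Van (fun i => φ (p i)) m (MvPolynomial.map φ F)) : Van p m F := by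
  intro b hb
  apply hφ
  rw [← coeff_map, map_trl, h b hb, map_zero]

open Classical in
lemma det_map {R S : Type*} [CommRing R] [CommRing S] (φ : R →+* S) (p : Fin 24 → Fin 4 → R)
    (L : Matrix ColIdx RowIdx R) :
    φ ((L * interp p).det) = (L.map φ * interp (fun j i => φ (p j i))).det := by
  rw [RingHom.map_det, RingHom.mapMatrix_apply, Matrix.map_mul, interp_map]

open Classical in
lemma char_zero_main {k : Type u} [Field k] (p : Fin 24 → Fin 4 → k)
    (L : Matrix ColIdx RowIdx k) (hL : (L * interp p).det ≠ 0)
    {d t : ℕ} (ht : 0 < t) {f : MvPolynomial (Fin 4) k} (hf0 : f ≠ 0) (hf : f.IsHomogeneous d)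
    (hv : ∀ j, Van (p j) t f) : 184 * t ≤ 72 * d := by
  obtain ⟨c, hc⟩ := (support_nonempty (p := f)).2 hf0
  rw [mem_support_iff] at hc
  set S : Set k := (Set.range fun q : Fin 24 × Fin 4 => p q.1 q.2) ∪
    (Set.range fun q : ColIdx × RowIdx => L q.1 q.2) ∪ ((fun b => coeff b f) '' f.support) ∪
    {((L * interp p).det)⁻¹, (coeff c f)⁻¹} with hS
  have hSfin : S.Finite :=
    (((Set.finite_range _).union (Set.finite_range _)).union
      (f.support.finite_toSet.image _)).union (Set.toFinite _)
  set A := Algebra.adjoin ℤ S with hA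
  have hft : Algebra.FiniteType ℤ A := Algebra.FiniteType.adjoin_of_finite hSfin
  have hsub : ∀ x ∈ S, x ∈ A := fun x hx => Algebra.subset_adjoin hx
  obtain ⟨F, _, hFfin, ⟨φ⟩⟩ := exists_finite_field A
  have := Fintype.ofFinite F
  let ι : A →+* k := A.val.toRingHom
  have hι : Function.Injective ι := Subtype.coe_injective
  let pA : Fin 24 → Fin 4 → A := fun j i => ⟨p j i, hsub _ (by
    left; left; left; exact ⟨(j, i), rfl⟩)⟩
  let LA : Matrix ColIdx RowIdx A := fun a b => ⟨L a b, hsub _ (by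
    left; left; right; exact ⟨(a, b), rfl⟩)⟩
  have hcoef : ∀ b, coeff b f ∈ A := by
    intro b
    by_cases hb : b ∈ f.support
    · exact hsub _ (by left; right; exact ⟨b, hb, rfl⟩)
    · rw [notMem_support_iff.1 hb]
      exact A.zero_mem
  let fA : MvPolynomial (Fin 4) A := ∑ b ∈ f.support, monomial b (⟨coeff b f, hcoef b⟩ : A)
  have hfA : MvPolynomial.map ι fA = f := by
    conv_rhs => rw [f.as_sum]
    simp only [fA, map_sum, map_monomial]
    rfl
  let uA : A := ⟨((L * interp p).det)⁻¹, hsub _ (by right; left; rfl)⟩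
  let cA : A := ⟨(coeff c f)⁻¹, hsub _ (by right; right; rfl)⟩
  have hu : (LA * interp pA).det * uA = 1 := by
    apply hι
    rw [map_mul, det_map, map_one]
    exact mul_inv_cancel₀ hL
  have hcc : coeff c fA * cA = 1 := by
    apply hι
    rw [map_mul, map_one, ← coeff_map, hfA]
    exact mul_inv_cancel₀ hc
  have hvA : ∀ j, Van (pA j) t fA := by
    intro j
    apply Van.of_map ι hι
    rw [hfA]
    exact hv j
  have hhomA : fA.IsHomogeneous d := by
    refine homog_of_degree fun b hb => homog_degree hf (b := b) ?_
    rw [← hfA, coeff_map]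
    exact fun h => hb (hι (h.trans (map_zero ι).symm))
  refine fin_main (fun j i => φ (pA j i)) (no_form_of_det _ (LA.map φ) ?_) ht
    (f := MvPolynomial.map φ fA) ?_ (hhomA.map φ) (fun j => (hvA j).map φ)
  · rw [← det_map]
    exact left_ne_zero_of_mul_eq_one (by rw [← map_mul, hu, map_one] : _ * φ uA = 1)
  · intro h
    have h1 : φ (coeff c fA) = 0 := by rw [← coeff_map, h, coeff_zero]
    have h2 := congrArg φ hcc
    rw [map_mul, h1, zero_mul, map_one] at h2
    exact zero_ne_one h2

lemma exists_form {k : Type*} [Field k] {p : Fin 4 → k} (hp : p ≠ 0) :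
    ∃ g : MvPolynomial (Fin 4) k, g ≠ 0 ∧ g.IsHomogeneous 1 ∧ eval p g = 0 := by
  by_cases h : p 0 = 0
  · exact ⟨X 0, X_ne_zero 0, isHomogeneous_X _ _, by simpa using h⟩
  · refine ⟨C (p 0) * X 1 - C (p 1) * X 0, ?_, ?_, ?_⟩
    · intro h0
      have := congrArg (eval (fun i : Fin 4 => if i = 1 then (1 : k) else 0)) h0
      simp at this
      exact h this
    · exact (isHomogeneous_C_mul_X _ _).sub (isHomogeneous_C_mul_X _ _)
    · simp [mul_comm]

lemma alpha_bound {k : Type u} [Field k] (p : Fin 24 → Fin 4 → k) (hp : ∀ j, p j ≠ 0)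
    (t B : ℕ) (hB : ∀ d, ∀ f : MvPolynomial (Fin 4) k, f ≠ 0 → f.IsHomogeneous d →
      (∀ j, Van (p j) t f) → B ≤ 72 * d) :
    B ≤ 72 * alpha (fatIdeal (N := 3) p fun _ => t * 1) := by
  have hne : { d | ∃ f ∈ fatIdeal (N := 3) p (fun _ => t * 1), f ≠ 0 ∧
      f.IsHomogeneous d }.Nonempty := by
    choose g hg0 hg1 hg using fun j => exists_form (hp j)
    refine ⟨∑ _j : Fin 24, 1 * t, ∏ j : Fin 24, g j ^ t, ?_, ?_, ?_⟩
    · rw [fatIdeal, Ideal.mem_iInf]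
      intro j
      rw [mul_one]
      refine Ideal.mem_of_dvd _ (Finset.dvd_prod_of_mem (fun j => g j ^ t) (Finset.mem_univ j)) ?_
      have hm : g j ∈ pointIdeal (p j) := by
        rw [pointIdeal]
        exact Ideal.subset_span ⟨⟨1, hg1 j⟩, hg j⟩
      exact Ideal.pow_mem_pow hm t
    · exact Finset.prod_ne_zero_iff.2 fun j _ => pow_ne_zero _ (hg0 j)
    · exact IsHomogeneous.prod _ _ _ fun j _ => (hg1 j).pow t
  obtain ⟨f, hf, hf0, hfh⟩ := Nat.sInf_mem hne
  refine hB _ f hf0 hfh fun j => ?_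
  rw [van_iff]
  rw [fatIdeal, Ideal.mem_iInf] at hf
  have := hf j
  rw [mul_one] at this
  refine Ideal.pow_right_mono ?_ t this
  rw [pointIdeal, Ideal.span_le]
  rintro g ⟨-, hg⟩
  exact hg

/-- For `24` points in general position in `ℙ³`, the radical ideal `I = I(1^{×24})`
satisfies `γ(I) ≥ 23/9`. -/
theorem statement12 (k : Type*) [Field k] [CharZero k] :
    Generic k 3 24 (fun p =>
      ∀ γ : ℝ, Tendsto (alphaSeq p (fun _ => 1)) atTop (nhds γ) → 23 / 9 ≤ γ) := by
  classical
  obtain ⟨L, hL⟩ := exists_left_inv k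
  let D : MvPolynomial (Fin 24 × Fin 4) k :=
    (L.map C * interp (fun j i => X (j, i))).det
  have hD : ∀ p : Fin 24 → Fin 4 → k, eval (fun q => p q.1 q.2) D = (L * interp p).det := by
    intro p
    have := det_map (eval (fun q : Fin 24 × Fin 4 => p q.1 q.2)) (fun j i => X (j, i)) (L.map C)
    simp only [eval_X] at this
    rw [show D = (L.map C * interp (fun j i => X (j, i))).det from rfl]
    convert! this using 4
    ext a b
    simp
  refine ⟨{D}, ⟨specialPt k, ?_, D, rfl, ?_⟩, ?_⟩
  · intro j h
    have := congrFun h 0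
    simp [specialPt] at this
  · rw [hD, hL, Matrix.det_one]
    exact one_ne_zero
  · rintro p hp ⟨_, rfl, hDp⟩ γ hγ
    rw [hD] at hDp
    refine ge_of_tendsto hγ ?_
    filter_upwards [eventually_gt_atTop 0] with t ht
    have hb : 184 * t ≤ 72 * alpha (fatIdeal (N := 3) p fun _ => t * 1) :=
      alpha_bound p hp t (184 * t) fun d f hf0 hf hv => char_zero_main p L hDp ht hf0 hf hv
    rw [alphaSeq, le_div_iff₀ (by exact_mod_cast ht)]
    have hb' : (184 : ℝ) * t ≤ 72 * (alpha (fatIdeal (N := 3) p fun _ => t * 1) : ℝ) := by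
      exact_mod_cast hb
    linarith
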